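/- Let K be a field of characteristic p > 0, 1 ≤ r < n, ω ∈ Ω^r_{K(z)/K} a rational r-form, and η_1,…,η_{r+1} ∈ Ω^1_{K(z)/K} closed 1-forms with ω∧η_i = 0 for every i, which are linearly independent over K(z^p). If η_1∧…∧η_r ≠ 0 and η_2∧…∧η_{r+1} ≠ 0, then ω has a rational first integral. -/

import Mathlib

/- Framework: rational function field `K(z) = K(z₁,…,zₙ)`, its subfield `K(zᵖ)` of
∂-constants, and rational differential forms modelled as the exterior algebra over `K(z)`
on the free module with basis `dz₁,…,dzₙ` (canonically isomorphic to the exterior powers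
of the Kähler differentials `Ω¹_{K(z)/K}`); the wedge product is the algebra product. -/

set_option synthInstance.maxHeartbeats 1000000
set_option maxHeartbeats 4000000

noncomputable section
open MvPolynomial

/-- The field of rational functions `K(z₁,…,zₙ)`. -/
abbrev Kz (K : Type) [Field K] (n : ℕ) := FractionRing (MvPolynomial (Fin n) K)

variable (K : Type) [Field K] (n : ℕ)

/-- The inclusion of polynomials into rational functions. -/
def toKz : MvPolynomial (Fin n) K →+* Kz K n := algebraMap _ _

/-- Rational differential forms on `Kⁿ`. -/
abbrev Forms (K : Type) [Field K] (n : ℕ) := ExteriorAlgebra (Kz K n) (Fin n → Kz K n)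

/-- The 1-form `dz i`. -/
def dz (i : Fin n) : Forms K n := ExteriorAlgebra.ι (Kz K n) (Pi.single i 1)

/-- The 1-form with coordinates `v` with respect to the basis `dz₁,…,dzₙ`. -/
def oneForm (v : Fin n → Kz K n) : Forms K n := ExteriorAlgebra.ι (Kz K n) v

/-- The `r`-form `dz_{s 0} ∧ ⋯ ∧ dz_{s (r-1)}`. -/
def dzP (r : ℕ) (s : Fin r → Fin n) : Forms K n := (List.ofFn fun i => dz K n (s i)).prod

/-- The partial derivative `∂/∂zᵢ`, extended from `K[z]` to `K(z)` by the quotient rule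
(applied to a chosen fraction representation; the value does not depend on the choice). -/
def pd (i : Fin n) (f : Kz K n) : Kz K n :=
  let a := (IsLocalization.sec (nonZeroDivisors (MvPolynomial (Fin n) K)) f).1
  let b := ((IsLocalization.sec (nonZeroDivisors (MvPolynomial (Fin n) K)) f).2 :
      MvPolynomial (Fin n) K)
  (toKz K n (pderiv i a) * toKz K n b - toKz K n a * toKz K n (pderiv i b)) / (toKz K n b) ^ 2

/-- The differential `df = ∑ᵢ (∂f/∂zᵢ) dzᵢ` of a rational function `f`. -/
def dd (f : Kz K n) : Forms K n := ∑ i, pd K n i f • dz K n i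

/-- The `r`-form with (rational) coefficients `c`. -/
def formOf (r : ℕ) (c : (Fin r → Fin n) → Kz K n) : Forms K n := ∑ s, c s • dzP K n r s

/-- The exterior derivative of the `r`-form with coefficients `c`:
`d(∑ c_s dz_s) = ∑ (d c_s) ∧ dz_s`. -/
def Dform (r : ℕ) (c : (Fin r → Fin n) → Kz K n) : Forms K n := ∑ s, dd K n (c s) * dzP K n r s

/-- The polynomial `r`-form with polynomial coefficients `c`. -/
def polyFormOf (r : ℕ) (c : (Fin r → Fin n) → MvPolynomial (Fin n) K) : Forms K n :=
  formOf K n r fun s => toKz K n (c s)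

/-- The exterior derivative of the polynomial `r`-form with coefficients `c`. -/
def Dpoly (r : ℕ) (c : (Fin r → Fin n) → MvPolynomial (Fin n) K) : Forms K n :=
  Dform K n r fun s => toKz K n (c s)

/-- The exterior derivative of the 1-form with coordinates `v`. -/
def d1 (v : Fin n → Kz K n) : Forms K n := ∑ j, dd K n (v j) * dz K n j

/-- The subfield `K(zᵖ) = K(z₁ᵖ,…,zₙᵖ) ⊆ K(z)` of ∂-constants. -/
def pConsts (p : ℕ) : Subfield (Kz K n) :=
  Subfield.closure (Set.range (algebraMap K (Kz K n)) ∪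
    Set.range fun i : Fin n => (toKz K n (X i)) ^ p)

/-- `F` is invariant by the `r`-form `ω`: `dF ≠ 0` and `F` divides `ω ∧ dF`,
the quotient being a polynomial `(r+1)`-form (the cofactor `Θ_F`). -/
def FormInvariant (r : ℕ) (ω : Forms K n) (F : MvPolynomial (Fin n) K) : Prop :=
  dd K n (toKz K n F) ≠ 0 ∧
    ∃ Θ : (Fin (r + 1) → Fin n) → MvPolynomial (Fin n) K,
      ω * dd K n (toKz K n F) = toKz K n F • polyFormOf K n (r + 1) Θ

/-- `f` is a rational first integral of the form `ω`: `df ≠ 0` and `ω ∧ df = 0`. -/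
def IsFirstIntegral (ω : Forms K n) (f : Kz K n) : Prop :=
  dd K n f ≠ 0 ∧ ω * dd K n f = 0

/-- The `K(zᵖ)`-subspace `Ω^r_{L_d/K(zᵖ)}` spanned by the forms
`z^I · dz_{s 0} ∧ ⋯ ∧ dz_{s (r-1)}` with `0 ≤ I j ≤ p−1` and `∑ I ≤ d`. -/
def Lforms (p d r : ℕ) : Submodule (pConsts K n p) (Forms K n) :=
  Submodule.span (pConsts K n p)
    { x | ∃ (I : Fin n → ℕ) (s : Fin r → Fin n), (∀ j, I j ≤ p - 1) ∧ (∑ j, I j ≤ d) ∧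
        x = toKz K n (∏ j, X j ^ I j) • dzP K n r s }

/-- `N_K(n,d,r) = dim_{K(zᵖ)} Ω^r_{L_d/K(zᵖ)}`. -/
def NK (p d r : ℕ) : ℕ := Module.finrank (pConsts K n p) (Lforms K n p d r)

/-- The submodule of `r`-forms (the `r`-th exterior power of the module of 1-forms). -/
def gradeR (r : ℕ) : Submodule (Kz K n) (Forms K n) :=
  (LinearMap.range (ExteriorAlgebra.ι (Kz K n) :
      (Fin n → Kz K n) →ₗ[Kz K n] Forms K n)) ^ r

section ExteriorAlgebra

variable {F V : Type*} [Field F] [AddCommGroup V] [Module F V]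

open CliffordAlgebra in
theorem ExteriorAlgebra.contractRight_mem_range_ι_pow (d : Module.Dual F V) (r : ℕ)
    {x : ExteriorAlgebra F V}
    (hx : x ∈ LinearMap.range (ExteriorAlgebra.ι F : V →ₗ[F] ExteriorAlgebra F V) ^ (r + 1)) :
    contractRight x d ∈
      LinearMap.range (ExteriorAlgebra.ι F : V →ₗ[F] ExteriorAlgebra F V) ^ r := by
  induction r generalizing x with
  | zero =>
    rw [zero_add, pow_one] at hx
    obtain ⟨v, rfl⟩ := hx
    rw [pow_zero]
    exact Submodule.mem_one.2 ⟨d v, (contractRight_ι (Q := 0) (d := d) v).symm⟩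
  | succ r ih =>
    rw [pow_succ] at hx
    induction hx using Submodule.mul_induction_on' with
    | mem_mul_mem m hm y hy =>
      obtain ⟨v, rfl⟩ := hy
      have h : contractRight (m * ExteriorAlgebra.ι F v) d
          = d v • m - contractRight m d * ExteriorAlgebra.ι F v :=
        contractRight_mul_ι (Q := 0) (d := d) v m
      rw [h]
      refine sub_mem (Submodule.smul_mem _ _ hm) ?_
      rw [pow_succ]
      exact Submodule.mul_mem_mul (ih hm) ⟨v, rfl⟩
    | add x _ y _ hx hy =>
      rw [map_add, LinearMap.add_apply]
      exact add_mem hx hy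

theorem LinearIndependent.exists_dual_apply {ι : Type*} {v : ι → V} (hv : LinearIndependent F v)
    (f : ι → F) : ∃ d : Module.Dual F V, ∀ i, d (v i) = f i := by
  obtain ⟨d, hd⟩ :=
    LinearMap.exists_extend (Finsupp.linearCombination F f ∘ₗ (hv.repr : _ →ₗ[F] ι →₀ F))
  refine ⟨d, fun i => ?_⟩
  have h := LinearMap.congr_fun hd ⟨v i, Submodule.subset_span ⟨i, rfl⟩⟩
  simpa [hv.repr_eq_single i ⟨v i, Submodule.subset_span ⟨i, rfl⟩⟩ rfl] using h

open CliffordAlgebra in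
/-- An `r`-form annihilated by more than `r` linearly independent `1`-forms vanishes. -/
theorem ExteriorAlgebra.eq_zero_of_mul_ι_eq_zero {r k : ℕ} (hrk : r < k)
    {v : Fin k → V} (hv : LinearIndependent F v) {ω : ExteriorAlgebra F V}
    (hω : ω ∈ LinearMap.range (ExteriorAlgebra.ι F : V →ₗ[F] ExteriorAlgebra F V) ^ r)
    (h : ∀ i, ω * ExteriorAlgebra.ι F (v i) = 0) : ω = 0 := by
  induction r generalizing k ω with
  | zero =>
    rw [pow_zero] at hω
    obtain ⟨c, rfl⟩ := Submodule.mem_one.1 hω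
    have h0 := h ⟨0, hrk⟩
    rw [← Algebra.smul_def, smul_eq_zero, ExteriorAlgebra.ι_eq_zero_iff] at h0
    rcases h0 with h0 | h0
    · rw [h0, map_zero]
    · exact absurd h0 (hv.ne_zero _)
  | succ r ih =>
    obtain ⟨k, rfl⟩ : ∃ l, k = l + 1 := ⟨k - 1, by omega⟩
    obtain ⟨d, hd⟩ := hv.exists_dual_apply (Pi.single 0 1)
    have key : ∀ i, d (v i) • ω = contractRight ω d * ExteriorAlgebra.ι F (v i) := fun i => by
      have h1 : contractRight (ω * ExteriorAlgebra.ι F (v i)) d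
          = d (v i) • ω - contractRight ω d * ExteriorAlgebra.ι F (v i) :=
        contractRight_mul_ι (Q := 0) (d := d) (v i) ω
      rw [h i, map_zero, LinearMap.zero_apply] at h1
      exact (sub_eq_zero.1 h1.symm)
    have hθ : contractRight ω d = 0 := by
      refine ih (k := k) (by omega) (v := fun i => v i.succ)
        (hv.comp _ (Fin.succ_injective _)) (contractRight_mem_range_ι_pow d r hω) fun i => ?_
      rw [← key, hd, Pi.single_eq_of_ne (Fin.succ_ne_zero i), zero_smul]
    have h0 := key 0
    rwa [hd, Pi.single_eq_same, one_smul, hθ, zero_mul] at h0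

open CliffordAlgebra in
/-- Cartan's lemma, in its weak form. -/
theorem ExteriorAlgebra.mem_span_of_sum_ι_mul_ι_eq_zero {ι : Type*} [Fintype ι] {α v : ι → V}
    (hv : LinearIndependent F v)
    (h : ∑ j, ExteriorAlgebra.ι F (α j) * ExteriorAlgebra.ι F (v j) = 0) (i : ι) :
    α i ∈ Submodule.span F (Set.range v) := by
  by_contra hi
  obtain ⟨d, hd, hker⟩ := Submodule.exists_le_ker_of_notMem hi
  have hdv : ∀ j, d (v j) = 0 := fun j => hker (Submodule.subset_span ⟨j, rfl⟩)
  have h1 : ∀ j, contractLeft d (ExteriorAlgebra.ι F (α j) * ExteriorAlgebra.ι F (v j))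
      = ExteriorAlgebra.ι F (d (α j) • v j) := fun j => by
    have h2 : contractLeft d (ExteriorAlgebra.ι F (α j) * ExteriorAlgebra.ι F (v j))
        = d (α j) • ExteriorAlgebra.ι F (v j)
          - ExteriorAlgebra.ι F (α j) * contractLeft d (ExteriorAlgebra.ι F (v j)) :=
      contractLeft_ι_mul (Q := 0) (d := d) _ _
    have h3 : contractLeft d (ExteriorAlgebra.ι F (v j)) = algebraMap F _ (d (v j)) :=
      contractLeft_ι (Q := 0) (d := d) _
    rw [h2, h3, hdv, map_zero, mul_zero, sub_zero, map_smul]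
  have h4 := congrArg (contractLeft d) h
  rw [map_sum, map_zero, Finset.sum_congr rfl fun j _ => h1 j, ← map_sum,
    ExteriorAlgebra.ι_eq_zero_iff] at h4
  exact hd (Fintype.linearIndependent_iff.1 hv _ h4 i)

theorem ExteriorAlgebra.mul_ι_eq_zero_of_mem_span {ι : Type*} {v : ι → V}
    {ω : ExteriorAlgebra F V} (h : ∀ i, ω * ExteriorAlgebra.ι F (v i) = 0) {x : V}
    (hx : x ∈ Submodule.span F (Set.range v)) : ω * ExteriorAlgebra.ι F x = 0 := by
  induction hx using Submodule.span_induction with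
  | mem x hx => obtain ⟨i, rfl⟩ := hx; exact h i
  | zero => rw [map_zero, mul_zero]
  | add x y _ _ hx hy => rw [map_add, mul_add, hx, hy, add_zero]
  | smul a x _ hx => rw [map_smul, mul_smul_comm, hx, smul_zero]

end ExteriorAlgebra

section Derivative

variable {K n}

theorem toKz_injective : Function.Injective (toKz K n) :=
  IsFractionRing.injective (MvPolynomial (Fin n) K) (Kz K n)

theorem toKz_ne_zero {b : MvPolynomial (Fin n) K} (hb : b ≠ 0) : toKz K n b ≠ 0 :=
  (map_ne_zero_iff _ toKz_injective).2 hb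

theorem exists_eq_toKz_div (f : Kz K n) :
    ∃ a b : MvPolynomial (Fin n) K, b ≠ 0 ∧ f = toKz K n a / toKz K n b := by
  obtain ⟨a, b, hb, h⟩ := IsFractionRing.div_surjective (A := MvPolynomial (Fin n) K) f
  exact ⟨a, b, nonZeroDivisors.ne_zero hb, h.symm⟩

theorem pd_div (i : Fin n) (a : MvPolynomial (Fin n) K) {b : MvPolynomial (Fin n) K}
    (hb : b ≠ 0) :
    pd K n i (toKz K n a / toKz K n b) =
      (toKz K n (pderiv i a) * toKz K n b - toKz K n a * toKz K n (pderiv i b)) /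
        (toKz K n b) ^ 2 := by
  unfold pd
  set f := toKz K n a / toKz K n b with hf
  set s := IsLocalization.sec (nonZeroDivisors (MvPolynomial (Fin n) K)) f with hs
  have hs2 : (s.2 : MvPolynomial (Fin n) K) ≠ 0 := nonZeroDivisors.ne_zero s.2.2
  have hsec : f * toKz K n s.2 = toKz K n s.1 :=
    IsLocalization.sec_spec (nonZeroDivisors (MvPolynomial (Fin n) K)) f
  generalize (s.2 : MvPolynomial (Fin n) K) = b₀ at *
  generalize s.1 = a₀ at *
  have hb' := toKz_ne_zero hb
  have hb₀ := toKz_ne_zero hs2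
  have e : a * b₀ = a₀ * b := by
    apply toKz_injective
    rw [map_mul, map_mul, ← hsec, hf]
    field_simp
  have e' := congrArg (toKz K n) (congrArg (pderiv i) e)
  have e'' := congrArg (toKz K n) e
  simp only [pderiv_mul, map_add, map_mul] at e' e''
  rw [div_eq_div_iff (pow_ne_zero _ hb₀) (pow_ne_zero _ hb')]
  generalize toKz K n a = A at *
  generalize toKz K n b = B at *
  generalize toKz K n a₀ = A₀ at *
  generalize toKz K n b₀ = B₀ at *
  generalize toKz K n (pderiv i a) = A' at *
  generalize toKz K n (pderiv i b) = B' at *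
  generalize toKz K n (pderiv i a₀) = A₀' at *
  generalize toKz K n (pderiv i b₀) = B₀' at *
  linear_combination (-B₀ * B) * e' + (B * B₀' + B₀ * B') * e''

theorem pd_mul (i : Fin n) (f g : Kz K n) :
    pd K n i (f * g) = f * pd K n i g + g * pd K n i f := by
  obtain ⟨a, b, hb, rfl⟩ := exists_eq_toKz_div f
  obtain ⟨c, e, he, rfl⟩ := exists_eq_toKz_div g
  rw [div_mul_div_comm, ← map_mul, ← map_mul, pd_div i _ (mul_ne_zero hb he), pd_div i _ hb,
    pd_div i _ he]
  have hb' := toKz_ne_zero hb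
  have he' := toKz_ne_zero he
  simp only [pderiv_mul, map_add, map_mul]
  field_simp
  ring

theorem pd_add (i : Fin n) (f g : Kz K n) :
    pd K n i (f + g) = pd K n i f + pd K n i g := by
  obtain ⟨a, b, hb, rfl⟩ := exists_eq_toKz_div f
  obtain ⟨c, e, he, rfl⟩ := exists_eq_toKz_div g
  rw [div_add_div _ _ (toKz_ne_zero hb) (toKz_ne_zero he), ← map_mul, ← map_mul, ← map_mul,
    ← map_add, pd_div i _ (mul_ne_zero hb he), pd_div i _ hb, pd_div i _ he]
  have hb' := toKz_ne_zero hb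
  have he' := toKz_ne_zero he
  simp only [pderiv_mul, map_add, map_mul]
  field_simp
  ring

theorem pd_toKz (i : Fin n) (a : MvPolynomial (Fin n) K) :
    pd K n i (toKz K n a) = toKz K n (pderiv i a) := by
  simpa using pd_div i a (one_ne_zero (α := MvPolynomial (Fin n) K))

theorem toKz_mem_pConsts {p : ℕ} [CharP K p] {a : MvPolynomial (Fin n) K}
    (h : ∀ i, pderiv i a = 0) : toKz K n a ∈ pConsts K n p := by
  rw [a.as_sum, map_sum]
  refine sum_mem fun m hm => ?_
  have hdvd : ∀ i, p ∣ m i := fun i => by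
    by_cases hmi : m i = 0
    · rw [hmi]; exact dvd_zero p
    have hle : Finsupp.single i 1 ≤ m := Finsupp.single_le_iff.2 (Nat.one_le_iff_ne_zero.2 hmi)
    have h1 := coeff_pderiv (i := i) a (m - Finsupp.single i 1)
    rw [h i, coeff_zero, tsub_add_cancel_of_le hle] at h1
    have h2 := (mul_eq_zero.1 h1.symm).resolve_left (mem_support_iff.1 hm)
    rw [← Nat.cast_succ, CharP.cast_eq_zero_iff K p] at h2
    simpa [Nat.sub_add_cancel (Nat.one_le_iff_ne_zero.2 hmi)] using h2
  rw [monomial_eq, map_mul, Finsupp.prod, map_prod]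
  refine mul_mem (Subfield.subset_closure (Set.mem_union_left _ ?_)) (prod_mem fun i _ => ?_)
  · refine ⟨coeff m a, ?_⟩
    exact IsScalarTower.algebraMap_apply K (MvPolynomial (Fin n) K) (Kz K n) _
  · obtain ⟨k, hk⟩ := hdvd i
    rw [hk, pow_mul, map_pow, map_pow]
    exact pow_mem (Subfield.subset_closure (Set.mem_union_right _ (Set.mem_range_self i))) _

theorem mem_pConsts_of_pd_eq_zero {p : ℕ} (hp : p.Prime) [CharP K p] {f : Kz K n}
    (h : ∀ i, pd K n i f = 0) : f ∈ pConsts K n p := by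
  obtain ⟨a, b, hb, rfl⟩ := exists_eq_toKz_div f
  have hb' := toKz_ne_zero hb
  have hbp : ∀ i, pderiv i (b ^ p) = 0 := fun i => by
    rw [pderiv_pow, CharP.cast_eq_zero (MvPolynomial (Fin n) K) p, zero_mul, zero_mul]
  have hP : b * (a * b ^ (p - 1)) = a * b ^ p := by
    obtain ⟨q, rfl⟩ : ∃ q, p = q + 1 := ⟨p - 1, by have := hp.pos; omega⟩
    rw [Nat.add_sub_cancel]
    ring
  have hP' : ∀ i, pderiv i (a * b ^ (p - 1)) = 0 := fun i => by
    have h1 := h i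
    rw [pd_div i _ hb, div_eq_zero_iff, or_iff_left (pow_ne_zero _ hb'), ← map_mul, ← map_mul,
      ← map_sub, map_eq_zero_iff _ toKz_injective] at h1
    have h2 := congrArg (pderiv i) hP
    rw [pderiv_mul, pderiv_mul (f := a) (g := b ^ p), hbp, mul_zero, add_zero] at h2
    generalize a * b ^ (p - 1) = P at *
    have h3 : b ^ 2 * pderiv i P = 0 := by
      linear_combination b * h2 + b ^ p * h1 - pderiv i b * hP
    exact (mul_eq_zero.1 h3).resolve_left (pow_ne_zero _ hb)
  have hf : toKz K n a / toKz K n b = toKz K n (a * b ^ (p - 1)) / toKz K n (b ^ p) := by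
    rw [div_eq_div_iff hb' (toKz_ne_zero (pow_ne_zero _ hb)), ← map_mul, ← map_mul, ← hP, mul_comm]
  rw [hf]
  exact div_mem (toKz_mem_pConsts hP') (toKz_mem_pConsts hbp)

theorem oneForm_eq_sum (v : Fin n → Kz K n) : oneForm K n v = ∑ k, v k • dz K n k := by
  unfold oneForm dz
  conv_lhs => rw [pi_eq_sum_univ' v]
  simp only [map_sum, map_smul]

theorem dd_eq_oneForm (f : Kz K n) : dd K n f = oneForm K n fun i => pd K n i f :=
  (oneForm_eq_sum _).symm

theorem dd_eq_zero_iff (f : Kz K n) : dd K n f = 0 ↔ ∀ i, pd K n i f = 0 := by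
  rw [dd_eq_oneForm, oneForm, ExteriorAlgebra.ι_eq_zero_iff, funext_iff]
  rfl

theorem dd_add (f g : Kz K n) : dd K n (f + g) = dd K n f + dd K n g := by
  simp only [dd, pd_add, add_smul, Finset.sum_add_distrib]

theorem dd_mul (f g : Kz K n) : dd K n (f * g) = f • dd K n g + g • dd K n f := by
  simp only [dd, pd_mul, add_smul, Finset.sum_add_distrib, Finset.smul_sum, smul_smul]

theorem dd_sum {ι : Type*} (s : Finset ι) (f : ι → Kz K n) :
    dd K n (∑ j ∈ s, f j) = ∑ j ∈ s, dd K n (f j) :=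
  map_sum (AddMonoidHom.mk' (dd K n) dd_add) f s

theorem d1_sum_smul {ι : Type*} (s : Finset ι) (a : ι → Kz K n) (η : ι → Fin n → Kz K n) :
    d1 K n (∑ j ∈ s, a j • η j) =
      ∑ j ∈ s, (a j • d1 K n (η j) + dd K n (a j) * oneForm K n (η j)) := by
  simp only [d1, oneForm_eq_sum, Finset.sum_apply, Pi.smul_apply, smul_eq_mul, dd_sum, dd_mul,
    Finset.sum_mul, add_mul, Finset.smul_sum, Finset.mul_sum, smul_mul_assoc, mul_smul_comm]
  rw [Finset.sum_comm]
  simp only [Finset.sum_add_distrib]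

end Derivative

/-- Let `K` have characteristic `p > 0`, `1 ≤ r < n`, let `ω` be a rational `r`-form and
let `η₁,…,η_{r+1}` be closed tangent 1-forms of `ω` which are linearly independent over
`K(zᵖ)`. If `η₁ ∧ ⋯ ∧ η_r ≠ 0` and `η₂ ∧ ⋯ ∧ η_{r+1} ≠ 0`, then `ω` has a rational first
integral. -/
theorem statement10 (p : ℕ) (hp : p.Prime) [CharP K p] (r : ℕ)
    (hr : 1 ≤ r) (hrn : r < n)
    (ω : Forms K n) (hω : ω ∈ gradeR K n r)
    (η : Fin (r + 1) → (Fin n → Kz K n))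
    (hclosed : ∀ i, d1 K n (η i) = 0)
    (htan : ∀ i, ω * oneForm K n (η i) = 0)
    (hli : LinearIndependent (pConsts K n p) fun i => oneForm K n (η i))
    (hw1 : (List.ofFn fun i : Fin r => oneForm K n (η i.castSucc)).prod ≠ 0)
    (hw2 : (List.ofFn fun i : Fin r => oneForm K n (η i.succ)).prod ≠ 0) :
    ∃ f : Kz K n, IsFirstIntegral K n ω f := by
  by_cases hω0 : ω = 0
  · let i : Fin n := ⟨0, by omega⟩
    refine ⟨toKz K n (X i), fun h => ?_, by rw [hω0, zero_mul]⟩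
    have h1 := (dd_eq_zero_iff _).1 h i
    rw [pd_toKz, pderiv_X_self, map_one] at h1
    exact one_ne_zero h1
  have hv : LinearIndependent (Kz K n) fun i : Fin r => η i.castSucc := by
    by_contra hdep
    exact hw1 ((ExteriorAlgebra.ιMulti (Kz K n) r).map_linearDependent _ hdep)
  have hlast : η (Fin.last r) ∈
      Submodule.span (Kz K n) (Set.range fun i : Fin r => η i.castSucc) := by
    by_contra hnot
    have hind := linearIndependent_finSnoc.2 ⟨hv, hnot⟩
    refine hω0 (ExteriorAlgebra.eq_zero_of_mul_ι_eq_zero (Nat.lt_succ_self r) hind hω fun i => ?_)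
    induction i using Fin.lastCases with
    | last => rw [Fin.snoc_last]; exact htan _
    | cast i => rw [Fin.snoc_castSucc]; exact htan _
  obtain ⟨a, ha⟩ := (Submodule.mem_span_range_iff_exists_fun _).1 hlast
  obtain ⟨i, hi⟩ : ∃ i, dd K n (a i) ≠ 0 := by
    by_contra! hall
    have hmem : ∀ i, a i ∈ pConsts K n p := fun i =>
      mem_pConsts_of_pd_eq_zero hp ((dd_eq_zero_iff _).1 (hall i))
    have hsum := Fintype.linearIndependent_iff.1 hli
      (Fin.snoc (α := fun _ => pConsts K n p) (fun i => ⟨a i, hmem i⟩) (-1)) ?_ (Fin.last r)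
    · rw [Fin.snoc_last, neg_eq_zero] at hsum
      exact one_ne_zero hsum
    · rw [Fin.sum_univ_castSucc]
      simp only [Fin.snoc_castSucc, Fin.snoc_last, neg_smul, one_smul]
      rw [← ha, ← sub_eq_add_neg, sub_eq_zero]
      unfold oneForm
      rw [map_sum]
      refine Finset.sum_congr rfl fun j _ => ?_
      rw [map_smul]
      rfl
  refine ⟨a i, hi, ?_⟩
  have hd := hclosed (Fin.last r)
  rw [← ha, d1_sum_smul] at hd
  simp only [hclosed, smul_zero, zero_add, dd_eq_oneForm] at hd
  rw [dd_eq_oneForm]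
  exact ExteriorAlgebra.mul_ι_eq_zero_of_mem_span (fun j => htan _)
    (ExteriorAlgebra.mem_span_of_sum_ι_mul_ι_eq_zero hv hd i)
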